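/- Let T > 0, H ∈ (1/2, 1), let k ≥ 2 be an integer, and let ℓ ∈ {1, …, k−1}. Set a := 1/2 − (1−H)/k and γ := H(1 − ℓ/k) + ℓ/k. Then ∫_{[0,T]^ℓ} ( ∫_0^T ( ∏_{i=1}^ℓ (u/x_i)^a (u − x_i)_+^{−(1−a)} )^{1/γ} du )^γ dx < ∞, where x = (x_1, …, x_ℓ) and (u)_+ := max{0, u}. -/

import Mathlib

open MeasureTheory Finset
open scoped ENNReal

/-- The integral of a product of functions of separate coordinates against a finite power of a
`σ`-finite measure factorises. -/
theorem lintegral_pi_fin_prod_eq_pow {α : Type*} [MeasurableSpace α] (μ : Measure α)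
    [SigmaFinite μ] {f : α → ℝ≥0∞} (hf : Measurable f) (n : ℕ) :
    ∫⁻ x, ∏ i, f (x i) ∂(Measure.pi fun _ : Fin n => μ) = (∫⁻ y, f y ∂μ) ^ n := by
  induction n with
  | zero => simp
  | succ n ih =>
    have hmp := (measurePreserving_piFinSuccAbove (fun _ : Fin (n + 1) => μ) 0).symm
    rw [← hmp.lintegral_comp_emb (MeasurableEquiv.measurableEmbedding _)]
    simp only [Fin.prod_univ_succ, MeasurableEquiv.piFinSuccAbove_symm_apply,
      Fin.insertNthEquiv_apply, Fin.insertNth_zero, Fin.cons_zero, Fin.cons_succ]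
    change ∫⁻ z : α × (Fin n → α), f z.1 * ∏ i, f (z.2 i) ∂(μ.prod (Measure.pi fun _ => μ)) = _
    have hprod : Measurable fun y : Fin n → α => ∏ i, f (y i) :=
      Finset.measurable_fun_prod _ fun i _ => hf.comp (measurable_pi_apply i)
    rw [lintegral_prod_mul hf.aemeasurable hprod.aemeasurable, ih, pow_succ']

/-- Pointwise bound of a power of the one-dimensional kernel `(u / x)^a (u - x)_+^{-(1-a)}` by
integrable power singularities at `0` and at `u`. -/
theorem rpow_kernel_le {a γ u x : ℝ} (ha : a ≤ 1 / 2) (haγ : 1 - a < γ) (hx : 0 < x)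
    (hxu : x < u) :
    ((u / x) ^ a * (max (u - x) 0) ^ (-(1 - a))) ^ (1 / γ) ≤
      x ^ (-((1 - a) / γ)) + (u - x) ^ (-((1 - a) / γ)) := by
  have hd : 0 < u - x := sub_pos.2 hxu
  have hu : 0 < u := hx.trans hxu
  have hγ : 0 < γ := by linarith
  rw [max_eq_left hd.le]
  calc ((u / x) ^ a * (u - x) ^ (-(1 - a))) ^ (1 / γ)
      ≤ ((u / x) ^ (1 - a) * (u - x) ^ (-(1 - a))) ^ (1 / γ) := by
        gcongr
        · exact (one_le_div hx).2 hxu.le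
        · linarith
    _ = (x⁻¹ + (u - x)⁻¹) ^ ((1 - a) / γ) := by
        rw [Real.rpow_neg hd.le, ← Real.inv_rpow hd.le,
          ← Real.mul_rpow (by positivity) (by positivity), ← Real.rpow_mul (by positivity)]
        congr 1
        · field_simp
          ring
        · ring
    _ ≤ x⁻¹ ^ ((1 - a) / γ) + (u - x)⁻¹ ^ ((1 - a) / γ) :=
        Real.rpow_add_le_add_rpow (by positivity) (by positivity)
          (div_nonneg (by linarith) hγ.le) ((div_le_one hγ).2 haγ.le)
    _ = x ^ (-((1 - a) / γ)) + (u - x) ^ (-((1 - a) / γ)) := by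
        rw [Real.inv_rpow hx.le, Real.inv_rpow hd.le, Real.rpow_neg hx.le, Real.rpow_neg hd.le]

/-- The integral over `x ∈ (0, T]` of the kernel raised to the power `1 / γ` is bounded uniformly in
`u ∈ (0, T]`. -/
theorem exists_lintegral_rpow_kernel_le {a γ : ℝ} (T : ℝ) (hT : 0 < T) (ha : a ≤ 1 / 2)
    (haγ : 1 - a < γ) :
    ∃ C : ℝ≥0∞, C < ⊤ ∧ ∀ u ∈ Set.Ioc 0 T, ∫⁻ x in Set.Ioc 0 T,
      ENNReal.ofReal (((u / x) ^ a * (max (u - x) 0) ^ (-(1 - a))) ^ (1 / γ)) ≤ C := by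
  have hγ : 0 < γ := by linarith
  set g : ℝ → ℝ≥0∞ :=
    (Set.Ioc 0 T).indicator fun y => ENNReal.ofReal (y ^ (-((1 - a) / γ))) with hg
  have hgm : Measurable g := Measurable.indicator (by fun_prop) measurableSet_Ioc
  have hfin : ∫⁻ y, g y < ⊤ := by
    rw [hg, lintegral_indicator measurableSet_Ioc]
    refine IntegrableOn.setLIntegral_lt_top ?_
    rw [← intervalIntegrable_iff_integrableOn_Ioc_of_le hT.le]
    exact intervalIntegral.intervalIntegrable_rpow' (neg_lt_neg ((div_lt_one hγ).2 haγ))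
  refine ⟨(∫⁻ y, g y) + ∫⁻ y, g y, ENNReal.add_lt_top.2 ⟨hfin, hfin⟩, fun u hu => ?_⟩
  calc ∫⁻ x in Set.Ioc 0 T,
        ENNReal.ofReal (((u / x) ^ a * (max (u - x) 0) ^ (-(1 - a))) ^ (1 / γ))
      ≤ ∫⁻ x in Set.Ioc 0 T, (g x + g (u - x)) := by
        refine setLIntegral_mono (by fun_prop) fun x hx => ?_
        rcases le_or_gt u x with hux | hxu
        · rw [max_eq_right (by linarith), Real.zero_rpow (by linarith), mul_zero,
            Real.zero_rpow (one_div_pos.2 hγ).ne', ENNReal.ofReal_zero]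
          exact zero_le
        · have hd : u - x ∈ Set.Ioc 0 T := ⟨by linarith, by linarith [hx.1, hu.2]⟩
          rw [hg, Set.indicator_of_mem hx, Set.indicator_of_mem hd, ← ENNReal.ofReal_add
            (Real.rpow_nonneg hx.1.le _) (Real.rpow_nonneg hd.1.le _)]
          exact ENNReal.ofReal_le_ofReal (rpow_kernel_le ha haγ hx.1 hxu)
    _ ≤ ∫⁻ x, (g x + g (u - x)) := setLIntegral_le_lintegral _ _
    _ = (∫⁻ y, g y) + ∫⁻ y, g y := by
        rw [lintegral_add_left hgm, lintegral_sub_left_eq_self g u]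

/-- If the sections of a jointly measurable kernel `F` have uniformly bounded integrals with respect
to a finite measure, then the `γ`-th powers, `0 < γ ≤ 1`, of the integrals of its tensor powers are
integrable. -/
theorem lintegral_rpow_lintegral_prod_lt_top {α β : Type*} [MeasurableSpace α] [MeasurableSpace β]
    (μ : Measure α) [IsFiniteMeasure μ] (ν : Measure β) [IsFiniteMeasure ν] {F : β → α → ℝ≥0∞}
    (hF : Measurable (Function.uncurry F)) {C : ℝ≥0∞} (hC : C < ⊤)
    (hbound : ∀ᵐ u ∂ν, ∫⁻ y, F u y ∂μ ≤ C) {γ : ℝ} (hγ₀ : 0 < γ) (hγ₁ : γ ≤ 1) (n : ℕ) :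
    ∫⁻ x, (∫⁻ u, ∏ i, F u (x i) ∂ν) ^ γ ∂(Measure.pi fun _ : Fin n => μ) < ⊤ := by
  have hjoint : Measurable (Function.uncurry fun (x : Fin n → α) u => ∏ i, F u (x i)) :=
    Finset.measurable_fun_prod _ fun i _ =>
      hF.comp (measurable_snd.prodMk ((measurable_pi_apply i).comp measurable_fst))
  calc ∫⁻ x, (∫⁻ u, ∏ i, F u (x i) ∂ν) ^ γ ∂(Measure.pi fun _ : Fin n => μ)
      ≤ ∫⁻ x, (1 + ∫⁻ u, ∏ i, F u (x i) ∂ν) ∂(Measure.pi fun _ : Fin n => μ) := by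
        refine lintegral_mono fun x => ?_
        rcases le_total (∫⁻ u, ∏ i, F u (x i) ∂ν) 1 with h | h
        · exact (ENNReal.rpow_le_one h hγ₀.le).trans le_self_add
        · exact ((ENNReal.rpow_le_rpow_of_exponent_le h hγ₁).trans_eq
            (ENNReal.rpow_one _)).trans le_add_self
    _ = (Measure.pi fun _ : Fin n => μ) Set.univ +
          ∫⁻ u, ∫⁻ x, ∏ i, F u (x i) ∂(Measure.pi fun _ : Fin n => μ) ∂ν := by
        rw [lintegral_add_left measurable_const, lintegral_one,
          lintegral_lintegral_swap hjoint.aemeasurable]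
    _ ≤ (Measure.pi fun _ : Fin n => μ) Set.univ + ∫⁻ _, C ^ n ∂ν := by
        refine add_le_add le_rfl (lintegral_mono_ae ?_)
        filter_upwards [hbound] with u hu
        rw [lintegral_pi_fin_prod_eq_pow μ (f := F u) (hF.comp measurable_prodMk_left)]
        exact pow_le_pow_left' hu n
    _ < ⊤ := by
        rw [lintegral_const]
        exact ENNReal.add_lt_top.2 ⟨measure_lt_top _ _,
          ENNReal.mul_lt_top (ENNReal.pow_lt_top hC) (measure_lt_top _ _)⟩

theorem lintegral_rpow_lintegral_prod_kernel_lt_top {a γ : ℝ} (T : ℝ) (hT : 0 < T)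
    (ha : a ≤ 1 / 2) (haγ : 1 - a < γ) (hγ : γ ≤ 1) (n : ℕ) :
    (∫⁻ x in Set.univ.pi fun _ : Fin n => Set.Ioc (0 : ℝ) T,
      (∫⁻ u in Set.Ioc (0 : ℝ) T, ENNReal.ofReal
        ((∏ i, (u / x i) ^ a * (max (u - x i) 0) ^ (-(1 - a))) ^ (1 / γ))) ^ γ) < ⊤ := by
  obtain ⟨C, hC, hbound⟩ := exists_lintegral_rpow_kernel_le T hT ha haγ
  have key := lintegral_rpow_lintegral_prod_lt_top (volume.restrict (Set.Ioc 0 T))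
    (volume.restrict (Set.Ioc 0 T)) (F := fun u y =>
      ENNReal.ofReal (((u / y) ^ a * (max (u - y) 0) ^ (-(1 - a))) ^ (1 / γ)))
    (by simp only [Function.uncurry_def]; fun_prop) hC
    ((ae_restrict_iff' measurableSet_Ioc).2 (.of_forall hbound)) (by linarith) hγ n
  rw [← Measure.restrict_pi_pi, ← volume_pi] at key
  refine lt_of_eq_of_lt (setLIntegral_congr_fun
    (MeasurableSet.univ_pi fun _ => measurableSet_Ioc) fun x hx => ?_) key
  refine congrArg (· ^ γ) (setLIntegral_congr_fun measurableSet_Ioc fun u hu => ?_)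
  have hnonneg : ∀ i, 0 ≤ (u / x i) ^ a * (max (u - x i) 0) ^ (-(1 - a)) := fun i =>
    mul_nonneg (Real.rpow_nonneg (div_nonneg hu.1.le (hx i trivial).1.le) _)
      (Real.rpow_nonneg (le_max_right _ _) _)
  rw [← Real.finsetProd_rpow _ _ fun i _ => hnonneg i,
    ENNReal.ofReal_prod_of_nonneg fun i _ => Real.rpow_nonneg (hnonneg i) _]

/-- For `H ∈ (1/2,1)`, an integer `k ≥ 2`, `ℓ ∈ {1,…,k-1}`, `a = 1/2 - (1-H)/k` and
`γ = H(1-ℓ/k) + ℓ/k`, the iterated integral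
`∫_{[0,T]^ℓ} (∫_0^T (∏_{i=1}^ℓ (u/x_i)^a (u-x_i)_+^{-(1-a)})^{1/γ} du)^γ dx` is finite. -/
theorem lintegral_hermite_kernel_lt_top (T H : ℝ) (hT : 0 < T)
    (hH : H ∈ Set.Ioo (1 / 2 : ℝ) 1) (k : ℕ) (hk : 2 ≤ k) (ℓ : ℕ) (hℓ : 1 ≤ ℓ)
    (hℓk : ℓ < k) :
    (∫⁻ x in Set.univ.pi fun _ : Fin ℓ => Set.Ioc (0 : ℝ) T,
      (∫⁻ u in Set.Ioc (0 : ℝ) T,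
          ENNReal.ofReal
            ((∏ i, (u / x i) ^ (1 / 2 - (1 - H) / (k : ℝ)) *
                (max (u - x i) 0) ^ (-(1 - (1 / 2 - (1 - H) / (k : ℝ))))) ^
              (1 / (H * (1 - (ℓ : ℝ) / (k : ℝ)) + (ℓ : ℝ) / (k : ℝ))))) ^
        (H * (1 - (ℓ : ℝ) / (k : ℝ)) + (ℓ : ℝ) / (k : ℝ))) < ⊤ := by
  obtain ⟨hH₁, hH₂⟩ := hH
  have hk0 : (0 : ℝ) < k := by positivity
  have hδ : 0 < (1 - H) / k := div_pos (by linarith) hk0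
  have hδk : (1 - H) / k * k = 1 - H := div_mul_cancel₀ _ hk0.ne'
  have hγ : H * (1 - (ℓ : ℝ) / k) + (ℓ : ℝ) / k = H + (1 - H) / k * ℓ := by ring
  have hℓ₁ : (1 : ℝ) ≤ ℓ := by exact_mod_cast hℓ
  have hℓ₂ : (ℓ : ℝ) ≤ k := by exact_mod_cast hℓk.le
  refine lintegral_rpow_lintegral_prod_kernel_lt_top T hT (by linarith) ?_ ?_ ℓ
  · rw [hγ]
    nlinarith
  · rw [hγ]
    nlinarith
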